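/- Let D = ℤ[A,B,C,D]/((C−D)² − AB) and let τ be the ring automorphism of D induced by the automorphism of ℤ[A,B,C,D] fixing A and B and swapping C and D (which preserves the ideal ((C−D)²−AB)). Then the fixed subring of D under τ is exactly the image in D of the ℤ-subalgebra generated by A, B, C+D, and CD. -/

import Mathlib

open MvPolynomial

noncomputable section

/- Variables in `MvPolynomial (Fin 4) ℤ`: `0 = A, 1 = B, 2 = C, 3 = D`. -/

/-- The defining ideal of `D = ℤ[A,B,C,D]/((C−D)² − AB)`. -/
def relIdeal : Ideal (MvPolynomial (Fin 4) ℤ) :=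
  Ideal.span {(X 2 - X 3) ^ 2 - X 0 * X 1}

/-- The automorphism of `ℤ[A,B,C,D]` fixing `A`, `B` and swapping `C`, `D`
(it preserves `((C−D)² − AB)`, hence induces the `ℤ/2`-action `τ` on the quotient). -/
def swapCD : MvPolynomial (Fin 4) ℤ →ₐ[ℤ] MvPolynomial (Fin 4) ℤ :=
  aeval ![X 0, X 1, X 3, X 2]

def symT : Subalgebra ℤ (MvPolynomial (Fin 4) ℤ) :=
  Algebra.adjoin ℤ {X 0, X 1, X 2 + X 3, X 2 * X 3}

lemma symT_swap (q : MvPolynomial (Fin 4) ℤ) (hq : q ∈ symT) : swapCD q = q := by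
  have h : symT ≤ AlgHom.equalizer swapCD (AlgHom.id ℤ (MvPolynomial (Fin 4) ℤ)) := by
    refine Algebra.adjoin_le ?_
    rintro x (rfl | rfl | rfl | rfl)
    · simp [AlgHom.mem_equalizer, swapCD]
    · simp [AlgHom.mem_equalizer, swapCD]
    · simp [AlgHom.mem_equalizer, swapCD, add_comm]
    · simp [AlgHom.mem_equalizer, swapCD, mul_comm]
  exact h hq

lemma mem_adjoin_iff' (x : MvPolynomial (Fin 4) ℤ ⧸ relIdeal) :
    x ∈ Algebra.adjoin ℤ
          ({Ideal.Quotient.mk relIdeal (X 0), Ideal.Quotient.mk relIdeal (X 1),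
            Ideal.Quotient.mk relIdeal (X 2 + X 3), Ideal.Quotient.mk relIdeal (X 2 * X 3)} :
            Set (MvPolynomial (Fin 4) ℤ ⧸ relIdeal)) ↔
      ∃ q ∈ symT, Ideal.Quotient.mk relIdeal q = x := by
  have h := AlgHom.map_adjoin (Ideal.Quotient.mkₐ ℤ relIdeal)
    ({X 0, X 1, X 2 + X 3, X 2 * X 3} : Set (MvPolynomial (Fin 4) ℤ))
  simp only [Set.image_insert_eq, Set.image_singleton, Ideal.Quotient.mkₐ_eq_mk] at h
  rw [← h, Subalgebra.mem_map]
  rfl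

lemma decomp (p : MvPolynomial (Fin 4) ℤ) :
    ∃ f ∈ symT, ∃ g ∈ symT, p = f + g * X 2 := by
  have h0 : (X 0 : MvPolynomial (Fin 4) ℤ) ∈ symT := Algebra.subset_adjoin (by simp)
  have h1 : (X 1 : MvPolynomial (Fin 4) ℤ) ∈ symT := Algebra.subset_adjoin (by simp)
  have h2 : (X 2 + X 3 : MvPolynomial (Fin 4) ℤ) ∈ symT := Algebra.subset_adjoin (by simp)
  have h3 : (X 2 * X 3 : MvPolynomial (Fin 4) ℤ) ∈ symT := Algebra.subset_adjoin (by simp)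
  induction p using MvPolynomial.induction_on with
  | C a => exact ⟨C a, symT.algebraMap_mem a, 0, symT.zero_mem, by simp⟩
  | add p q hp hq =>
    obtain ⟨f, hf, g, hg, rfl⟩ := hp
    obtain ⟨f', hf', g', hg', rfl⟩ := hq
    exact ⟨f + f', symT.add_mem hf hf', g + g', symT.add_mem hg hg', by ring⟩
  | mul_X p i hp =>
    obtain ⟨f, hf, g, hg, rfl⟩ := hp
    fin_cases i
    · exact ⟨f * X 0, symT.mul_mem hf h0, g * X 0, symT.mul_mem hg h0, by
        simp only [Fin.zero_eta]; ring⟩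
    · exact ⟨f * X 1, symT.mul_mem hf h1, g * X 1, symT.mul_mem hg h1, by
        simp only [Fin.mk_one]; ring⟩
    · exact ⟨-(g * (X 2 * X 3)), symT.neg_mem (symT.mul_mem hg h3), f + g * (X 2 + X 3),
        symT.add_mem hf (symT.mul_mem hg h2), by
        simp only [Fin.reduceFinMk]; ring⟩
    · exact ⟨f * (X 2 + X 3) + g * (X 2 * X 3),
        symT.add_mem (symT.mul_mem hf h2) (symT.mul_mem hg h3), -f,
        symT.neg_mem hf, by
        simp only [Fin.reduceFinMk]; ring⟩

def collapse : MvPolynomial (Fin 4) ℤ →ₐ[ℤ] MvPolynomial (Fin 4) ℤ :=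
  aeval ![X 0, X 1, X 2, X 2]

lemma dvd_sub_collapse (p : MvPolynomial (Fin 4) ℤ) :
    (X 2 - X 3 : MvPolynomial (Fin 4) ℤ) ∣ p - collapse p := by
  induction p using MvPolynomial.induction_on with
  | C a => simp [collapse]
  | add p q hp hq =>
    rw [map_add, add_sub_add_comm]
    exact dvd_add hp hq
  | mul_X p i hp =>
    have hX : (X 2 - X 3 : MvPolynomial (Fin 4) ℤ) ∣ X i - collapse (X i) := by
      fin_cases i
      · simp [collapse]
      · simp [collapse]
      · simp [collapse]
      · exact ⟨-1, by simp [collapse]⟩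
    have : p * X i - collapse (p * X i)
        = (p - collapse p) * X i + collapse p * (X i - collapse (X i)) := by
      rw [map_mul]; ring
    rw [this]
    exact dvd_add (hp.mul_right _) (hX.mul_left _)

lemma cancel_mem (g : MvPolynomial (Fin 4) ℤ) (h : g * (X 2 - X 3) ∈ relIdeal) :
    g ∈ relIdeal := by
  rw [relIdeal, Ideal.mem_span_singleton] at h ⊢
  obtain ⟨k, hk⟩ := h
  have h1 := congrArg collapse hk
  have h2 : collapse k = 0 := by
    simp only [map_mul, map_sub, map_pow] at h1
    simpa [collapse, X_ne_zero] using h1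
  have h3 := dvd_sub_collapse k
  rw [h2, sub_zero] at h3
  obtain ⟨m, rfl⟩ := h3
  have hne : (X 2 - X 3 : MvPolynomial (Fin 4) ℤ) ≠ 0 := by
    rw [sub_ne_zero]
    intro h
    exact absurd (X_injective h) (by decide)
  exact ⟨m, mul_right_cancel₀ hne (by rw [hk]; ring)⟩

lemma swap_mem (q : MvPolynomial (Fin 4) ℤ) (h : q ∈ relIdeal) : swapCD q ∈ relIdeal := by
  rw [relIdeal, Ideal.mem_span_singleton] at h ⊢
  obtain ⟨k, rfl⟩ := h
  refine ⟨swapCD k, ?_⟩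
  rw [map_mul]
  congr 1
  simp [swapCD]
  ring

/-- In `D = ℤ[A,B,C,D]/((C−D)² − AB)` with the `ℤ/2`-action `τ` induced by swapping `C`
and `D`, the fixed subring is exactly the image of the `ℤ`-subalgebra generated by
`A`, `B`, `C+D` and `CD`.  (Every element of `D` is `mk p`, and `τ (mk p) = mk (swapCD p)`.) -/
theorem fixed_points_swap (p : MvPolynomial (Fin 4) ℤ) :
    Ideal.Quotient.mk relIdeal (swapCD p) = Ideal.Quotient.mk relIdeal p ↔
      Ideal.Quotient.mk relIdeal p ∈
        Algebra.adjoin ℤ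
          ({Ideal.Quotient.mk relIdeal (X 0), Ideal.Quotient.mk relIdeal (X 1),
            Ideal.Quotient.mk relIdeal (X 2 + X 3), Ideal.Quotient.mk relIdeal (X 2 * X 3)} :
            Set (MvPolynomial (Fin 4) ℤ ⧸ relIdeal)) := by
  rw [mem_adjoin_iff']
  constructor
  · intro h
    obtain ⟨f, hf, g, hg, rfl⟩ := decomp p
    refine ⟨f, hf, ?_⟩
    rw [map_add, map_mul, symT_swap f hf, symT_swap g hg, eq_comm, Ideal.Quotient.eq] at h
    have hx : swapCD (X 2) = X 3 := by simp [swapCD]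
    rw [hx] at h
    have hg' : g ∈ relIdeal := cancel_mem g (by convert h using 1; ring)
    rw [eq_comm, Ideal.Quotient.eq]
    have := relIdeal.mul_mem_right (X 2) hg'
    convert this using 1
    ring
  · rintro ⟨q, hq, h⟩
    rw [← h]
    rw [eq_comm, Ideal.Quotient.eq] at h
    have h' := swap_mem _ h
    rw [map_sub, symT_swap q hq] at h'
    exact Ideal.Quotient.eq.2 h'
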